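/- arXiv:1806.00448 — 4 statements merged into one kernel-verified Lean document; each statement's English description precedes it below -/
import Mathlib

section
/- Let C ⊆ F_q^{n×m} be an F_q-linear code with minimum rank distance d, let 0 ≤ t < d, and let E = span(e_1,...,e_t) ⊆ F_q^n. Then the projection π_t deleting the first t rows restricts to a bijection between the set of codewords of C of rank exactly d whose column space contains E, and the set of matrices of rank exactly d−t in the punctured code π_t(C). -/
/-- The column space (support) of a matrix. -/
def colSpan {F : Type*} [Field F] {n m : ℕ} (X : Matrix (Fin n) (Fin m) F) :
    Submodule F (Fin n → F) :=
  LinearMap.range X.mulVecLin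

/-- Delete the first `t` rows of an `n × m` matrix (the projection `π_t`). -/
def dropRows {F : Type*} {n m t : ℕ} (h : t ≤ n) (X : Matrix (Fin n) (Fin m) F) :
    Matrix (Fin (n - t)) (Fin m) F :=
  Matrix.of fun i j => X (Fin.cast (by omega) (Fin.natAdd t i)) j

/-- The linear map on column vectors that forgets the first `t` coordinates. -/
def dropCoords (F : Type*) [Field F] {n t : ℕ} (h : t ≤ n) :
    (Fin n → F) →ₗ[F] (Fin (n - t) → F) :=
  LinearMap.funLeft F F fun i => Fin.cast (by omega) (Fin.natAdd t i)

theorem dropCoords_surjective (F : Type*) [Field F] {n t : ℕ} (h : t ≤ n) :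
    Function.Surjective (dropCoords F h) := by
  refine LinearMap.funLeft_surjective_of_injective F F _ fun i j hij => ?_
  simpa [Fin.ext_iff] using hij

theorem finrank_ker_dropCoords (F : Type*) [Field F] {n t : ℕ} (h : t ≤ n) :
    Module.finrank F (LinearMap.ker (dropCoords F h)) = t := by
  have hk := LinearMap.finrank_range_add_finrank_ker (dropCoords F h)
  rw [LinearMap.range_eq_top.2 (dropCoords_surjective F h), finrank_top] at hk
  simp only [Module.finrank_fin_fun] at hk
  omega

theorem span_single_eq_ker_dropCoords (F : Type*) [Field F] {n t : ℕ} (h : t ≤ n) :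
    Submodule.span F (Set.range fun i : Fin t =>
      (Pi.single (Fin.castLE h i) 1 : Fin n → F)) = LinearMap.ker (dropCoords F h) := by
  apply le_antisymm
  · rw [Submodule.span_le]
    rintro _ ⟨i, rfl⟩
    ext j
    refine Pi.single_eq_of_ne (fun hij => ?_) 1
    have := congrArg Fin.val hij
    simp at this
    omega
  · intro v hv
    rw [pi_eq_sum_univ' v]
    refine Submodule.sum_mem _ fun i _ => ?_
    by_cases hi : i.val < t
    · refine Submodule.smul_mem _ _ (Submodule.subset_span ⟨⟨i, hi⟩, ?_⟩)
      ext j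
      simp [Pi.single_apply, Fin.ext_iff]
    · have hvi : v i = 0 := by
        have := congrFun (LinearMap.mem_ker.1 hv) ⟨i - t, by omega⟩
        simp only [dropCoords, LinearMap.funLeft_apply, Pi.zero_apply] at this
        rw [← this]
        congr 1
        ext
        simp
        omega
      simp [hvi]

theorem colSpan_dropRows {F : Type*} [Field F] {n m t : ℕ} (h : t ≤ n)
    (X : Matrix (Fin n) (Fin m) F) :
    colSpan (dropRows h X) = (colSpan X).map (dropCoords F h) := by
  rw [colSpan, colSpan, ← LinearMap.range_comp]
  rfl

/-- Rank–nullity for the puncturing map on the column space. -/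
theorem rank_dropRows_add_finrank_inf_ker {F : Type*} [Field F] {n m t : ℕ} (h : t ≤ n)
    (X : Matrix (Fin n) (Fin m) F) :
    (dropRows h X).rank +
      Module.finrank F ↥(colSpan X ⊓ LinearMap.ker (dropCoords F h)) = X.rank := by
  have hk := LinearMap.finrank_range_add_finrank_ker ((dropCoords F h).domRestrict (colSpan X))
  rw [LinearMap.range_domRestrict, ← colSpan_dropRows, LinearMap.ker_domRestrict] at hk
  rw [← Submodule.map_comap_subtype, Submodule.finrank_map_subtype_eq]
  exact hk

theorem stmt_3 {F : Type*} [Field F] {n m d t : ℕ}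
    (C : Submodule F (Matrix (Fin n) (Fin m) F))
    (hmin : ∀ X ∈ C, X ≠ 0 → d ≤ X.rank)
    (hex : ∃ X ∈ C, X ≠ 0 ∧ X.rank = d)
    (ht : t < d) (htn : t ≤ n) :
    Set.BijOn (dropRows htn)
      {X | X ∈ C ∧ X.rank = d ∧
        Submodule.span F (Set.range fun i : Fin t =>
          (Pi.single (Fin.castLE htn i) 1 : Fin n → F)) ≤ colSpan X}
      {Y | Y ∈ dropRows htn '' (C : Set (Matrix (Fin n) (Fin m) F)) ∧ Y.rank = d - t} := by
  rw [span_single_eq_ker_dropCoords]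
  have hker := finrank_ker_dropCoords F htn
  have hle (X : Matrix (Fin n) (Fin m) F) :
      Module.finrank F ↥(colSpan X ⊓ LinearMap.ker (dropCoords F htn)) ≤ t :=
    (Submodule.finrank_mono inf_le_right).trans hker.le
  refine ⟨?_, ?_, ?_⟩
  · rintro X ⟨hX, hr, hE⟩
    refine ⟨⟨X, hX, rfl⟩, ?_⟩
    have hrank := rank_dropRows_add_finrank_inf_ker htn X
    rw [inf_eq_right.2 hE, hker] at hrank
    omega
  · rintro X ⟨hX, -⟩ X' ⟨hX', -⟩ hXX'
    by_contra hne
    have hd := hmin _ (C.sub_mem hX hX') (sub_ne_zero.2 hne)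
    have hzero : dropRows htn (X - X') = 0 := by
      change dropRows htn X - dropRows htn X' = 0
      exact sub_eq_zero.2 hXX'
    have hrank := rank_dropRows_add_finrank_inf_ker htn (X - X')
    rw [hzero, Matrix.rank_zero] at hrank
    have := hle (X - X')
    omega
  · rintro _ ⟨⟨X, hX, rfl⟩, hr⟩
    have hne : X ≠ 0 := by
      rintro rfl
      have hzero : dropRows htn (0 : Matrix (Fin n) (Fin m) F) = 0 := rfl
      rw [hzero, Matrix.rank_zero] at hr
      omega
    have hd := hmin X hX hne
    have hrank := rank_dropRows_add_finrank_inf_ker htn X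
    have := hle X
    refine ⟨X, ⟨hX, by omega, ?_⟩, rfl⟩
    exact inf_eq_right.1 (Submodule.eq_of_le_of_finrank_eq inf_le_right (by omega))
end

section
/- Let C ⊆ F_q^{n×m} be an F_q-linear code with minimum rank distance d, 0 ≤ t < d, and T ⊆ F_q^n any t-dimensional subspace. Then there exists an invertible matrix A ∈ GL_n(F_q) such that the number of codewords of C of rank d whose column space contains T equals the number of matrices of rank d−t in the punctured code Π(C,A,t) = {π_t(AX) : X ∈ C}. -/
open Module in
theorem Submodule.finrank_map_add_finrank_inf_ker {K V W : Type*} [DivisionRing K]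
    [AddCommGroup V] [Module K V] [AddCommGroup W] [Module K W]
    (f : V →ₗ[K] W) (S : Submodule K V) [FiniteDimensional K S] :
    finrank K (S.map f) + finrank K (S ⊓ LinearMap.ker f : Submodule K V) = finrank K S := by
  have h := (f.domRestrict S).finrank_range_add_finrank_ker
  rw [LinearMap.range_domRestrict, LinearMap.ker_domRestrict] at h
  rw [← h, ← finrank_map_subtype_eq S (Submodule.comap S.subtype (LinearMap.ker f)),
    Submodule.map_comap_subtype]

theorem rank_mul_add_finrank_colSpan_inf_ker {F : Type*} [Field F] {k n m : ℕ}
    (P : Matrix (Fin k) (Fin n) F) (X : Matrix (Fin n) (Fin m) F) :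
    (P * X).rank + Module.finrank F
      (colSpan X ⊓ LinearMap.ker P.mulVecLin : Submodule F (Fin n → F)) = X.rank := by
  rw [Matrix.rank, Matrix.mulVecLin_mul, LinearMap.range_comp]
  exact Submodule.finrank_map_add_finrank_inf_ker P.mulVecLin (colSpan X)

theorem dropRows_mul {F : Type*} [Field F] {n m k t : ℕ} (h : t ≤ n)
    (A : Matrix (Fin n) (Fin k) F) (X : Matrix (Fin k) (Fin m) F) :
    dropRows h (A * X) = dropRows h A * X :=
  rfl

theorem exists_ker_dropRows_eq {F : Type*} [Field F] {n t : ℕ} (htn : t ≤ n)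
    (T : Submodule F (Fin n → F)) (hT : Module.finrank F T = t) :
    ∃ A : GL (Fin n) F,
      LinearMap.ker (dropRows htn (A : Matrix (Fin n) (Fin n) F)).mulVecLin = T := by
  let ι : Fin (n - t) → Fin n := fun i => Fin.cast (by omega) (Fin.natAdd t i)
  have hι : Function.Injective ι := fun i j hij => by
    simpa [ι, Fin.ext_iff] using hij
  let π := LinearMap.funLeft F F ι
  have hK : Module.finrank F (LinearMap.ker π) = t := by
    have h := π.finrank_range_add_finrank_ker
    rw [LinearMap.range_eq_top.2 (LinearMap.funLeft_surjective_of_injective F F ι hι),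
      finrank_top, Module.finrank_fin_fun, Module.finrank_fin_fun] at h
    omega
  obtain ⟨g, hg⟩ := Submodule.exists_linearEquiv_restrict_eq
    (LinearEquiv.ofFinrankEq T (LinearMap.ker π) (hT.trans hK.symm))
  have hmap : T.map (g : (Fin n → F) →ₗ[F] Fin n → F) = LinearMap.ker π := by
    refine Submodule.eq_of_le_of_finrank_eq ?_ ?_
    · rintro _ ⟨x, hx, rfl⟩
      exact hg ⟨x, hx⟩ ▸ Subtype.coe_prop _
    · exact (LinearEquiv.finrank_map_eq g T).trans (hT.trans hK.symm)
  let A := Matrix.GeneralLinearGroup.toLin.symm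
    ((LinearMap.GeneralLinearGroup.generalLinearEquiv F (Fin n → F)).symm g)
  have hA : ∀ v, (A : Matrix (Fin n) (Fin n) F).mulVec v = g v := fun v => by
    have h := Matrix.GeneralLinearGroup.toLin_apply A v
    rw [MulEquiv.apply_symm_apply] at h
    exact h.symm
  refine ⟨A, ?_⟩
  ext v
  have hv : (dropRows htn (A : Matrix (Fin n) (Fin n) F)).mulVecLin v = π (g v) := by
    rw [← hA]
    rfl
  rw [LinearMap.mem_ker, hv, ← LinearMap.mem_ker, ← hmap]
  exact g.injective.mem_set_image (s := (T : Set (Fin n → F)))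

theorem stmt_4 {F : Type*} [Field F] {n m d t : ℕ}
    (C : Submodule F (Matrix (Fin n) (Fin m) F))
    (hmin : ∀ X ∈ C, X ≠ 0 → d ≤ X.rank)
    (hex : ∃ X ∈ C, X ≠ 0 ∧ X.rank = d)
    (ht : t < d) (htn : t ≤ n)
    (T : Submodule F (Fin n → F)) (hT : Module.finrank F T = t) :
    ∃ A : GL (Fin n) F,
      {X | X ∈ C ∧ X.rank = d ∧ T ≤ colSpan X}.ncard =
      {Y : Matrix (Fin (n - t)) (Fin m) F |
        (∃ X ∈ C, dropRows htn ((A : Matrix (Fin n) (Fin n) F) * X) = Y) ∧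
        Y.rank = d - t}.ncard := by
  obtain ⟨A, hA⟩ := exists_ker_dropRows_eq htn T hT
  refine ⟨A, ?_⟩
  simp only [dropRows_mul]
  set P := dropRows htn (A : Matrix (Fin n) (Fin n) F)
  have hrank : ∀ X : Matrix (Fin n) (Fin m) F, (P * X).rank + Module.finrank F
      (colSpan X ⊓ T : Submodule F (Fin n → F)) = X.rank := fun X => by
    rw [← hA]
    exact rank_mul_add_finrank_colSpan_inf_ker P X
  have hle : ∀ X : Matrix (Fin n) (Fin m) F,
      Module.finrank F (colSpan X ⊓ T : Submodule F (Fin n → F)) ≤ t := fun X =>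
    hT ▸ Submodule.finrank_mono inf_le_right
  refine Set.BijOn.ncard_eq (f := fun X => P * X) ⟨?_, ?_, ?_⟩
  · rintro X ⟨hX, hXd, hTX⟩
    refine ⟨⟨X, hX, rfl⟩, ?_⟩
    have h := hrank X
    rw [inf_eq_right.2 hTX, hT, hXd] at h
    dsimp only
    omega
  · rintro X ⟨hX, -, -⟩ X' ⟨hX', -, -⟩ h
    by_contra hne
    have hd := hmin _ (C.sub_mem hX hX') (sub_ne_zero.2 hne)
    have h₁ := hrank (X - X')
    have h₂ := hle (X - X')
    rw [Matrix.mul_sub, sub_eq_zero.2 h, Matrix.rank_zero] at h₁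
    omega
  · rintro _ ⟨⟨X, hX, rfl⟩, hY⟩
    have h₁ := hrank X
    have h₂ := hle X
    have hX0 : X ≠ 0 := by
      rintro rfl
      rw [Matrix.mul_zero, Matrix.rank_zero] at hY
      omega
    have hd := hmin X hX hX0
    refine ⟨X, ⟨hX, by omega, ?_⟩, rfl⟩
    exact inf_eq_right.1 (Submodule.eq_of_le_of_finrank_eq inf_le_right (by omega))
end

section
/- Let m ≥ n and let C ⊆ F_q^{n×m} be an F_q-linear MRD code of dimension k = m(n−d+1) and minimum rank distance d. Then for every d-dimensional subspace U ≤ F_q^n, the number of codewords of C whose column space is contained in U equals q^m. -/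
/-- The space of matrices all of whose columns lie in `U`. -/
def colSubmodule {F : Type*} [Field F] {n : ℕ} (m : ℕ) (U : Submodule F (Fin n → F)) :
    Submodule F (Matrix (Fin n) (Fin m) F) where
  carrier := {X | ∀ j, X.col j ∈ U}
  add_mem' hX hY j := U.add_mem (hX j) (hY j)
  zero_mem' _ := U.zero_mem
  smul_mem' c _ hX j := U.smul_mem c (hX j)

lemma mem_colSubmodule {F : Type*} [Field F] {n m : ℕ} {U : Submodule F (Fin n → F)}
    {X : Matrix (Fin n) (Fin m) F} : X ∈ colSubmodule m U ↔ ∀ j, X.col j ∈ U :=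
  Iff.rfl

lemma mem_colSubmodule_iff_colSpan_le {F : Type*} [Field F] {n m : ℕ}
    {U : Submodule F (Fin n → F)} {X : Matrix (Fin n) (Fin m) F} :
    X ∈ colSubmodule m U ↔ colSpan X ≤ U := by
  rw [mem_colSubmodule, colSpan, Matrix.range_mulVecLin, Submodule.span_le,
    Set.range_subset_iff]
  rfl

/-- A matrix with columns in `U` is a family of vectors of `U`. -/
def colSubmoduleEquiv {F : Type*} [Field F] {n : ℕ} (m : ℕ) (U : Submodule F (Fin n → F)) :
    colSubmodule m U ≃ₗ[F] (Fin m → U) where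
  toFun X j := ⟨X.1.col j, X.2 j⟩
  invFun f := ⟨Matrix.of fun i j => (f j).1 i, fun j => (f j).2⟩
  map_add' _ _ := rfl
  map_smul' _ _ := rfl
  left_inv _ := rfl
  right_inv _ := rfl

lemma finrank_colSubmodule {F : Type*} [Field F] {n : ℕ} (m : ℕ)
    (U : Submodule F (Fin n → F)) :
    Module.finrank F (colSubmodule m U) = m * Module.finrank F U := by
  rw [(colSubmoduleEquiv m U).finrank_eq, Module.finrank_pi_fintype]
  simp

lemma colSubmodule_mono {F : Type*} [Field F] {n : ℕ} (m : ℕ)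
    {U V : Submodule F (Fin n → F)} (h : U ≤ V) : colSubmodule m U ≤ colSubmodule m V :=
  fun _ hX j => h (hX j)

lemma rank_le_of_mem_colSubmodule {F : Type*} [Field F] {n m : ℕ}
    {U : Submodule F (Fin n → F)} {X : Matrix (Fin n) (Fin m) F} (hX : X ∈ colSubmodule m U) :
    X.rank ≤ Module.finrank F U :=
  Submodule.finrank_mono (mem_colSubmodule_iff_colSpan_le.1 hX)

lemma exists_le_finrank_eq {F E : Type*} [Field F] [AddCommGroup E] [Module F E]
    (U : Submodule F E) {r : ℕ} (hr : r ≤ Module.finrank F U) :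
    ∃ V ≤ U, Module.finrank F V = r := by
  obtain ⟨f, hf⟩ := exists_linearIndependent_of_le_finrank hr
  refine ⟨(Submodule.span F (Set.range f)).map U.subtype, Submodule.map_subtype_le U _, ?_⟩
  rw [Submodule.finrank_map_subtype_eq, finrank_span_eq_card hf, Fintype.card_fin]

/-- In a maximum rank distance code of minimum distance `d`, the codewords supported in a
`d`-dimensional space form a space of dimension `m`. -/
lemma finrank_inf_colSubmodule {F : Type*} [Field F] {n m d : ℕ} (hd1 : 1 ≤ d) (hdn : d ≤ n)
    (C : Submodule F (Matrix (Fin n) (Fin m) F))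
    (hk : Module.finrank F C = m * (n - d + 1))
    (hmin : ∀ X ∈ C, X ≠ 0 → d ≤ X.rank)
    (U : Submodule F (Fin n → F)) (hU : Module.finrank F U = d) :
    Module.finrank F (C ⊓ colSubmodule m U : Submodule F _) = m := by
  obtain ⟨e, rfl⟩ := Nat.exists_eq_add_of_le' hd1
  obtain ⟨V, hVU, hV⟩ := exists_le_finrank_eq U (r := e) (by omega)
  have hbot : (C ⊓ colSubmodule m U) ⊓ colSubmodule m V = ⊥ := by
    rw [eq_bot_iff]
    rintro X ⟨⟨hXC, -⟩, hXV⟩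
    by_contra hX
    have h1 := hmin X hXC hX
    have h2 := rank_le_of_mem_colSubmodule hXV
    omega
  have hupper := Submodule.finrank_sup_add_finrank_inf_eq
    (C ⊓ colSubmodule m U) (colSubmodule m V)
  have hle := Submodule.finrank_mono
    (sup_le (inf_le_right : C ⊓ colSubmodule m U ≤ _) (colSubmodule_mono m hVU))
  rw [hbot, finrank_bot, finrank_colSubmodule, hV] at hupper
  rw [finrank_colSubmodule, hU, Nat.mul_succ] at hle
  have hlower := Submodule.finrank_sup_add_finrank_inf_eq C (colSubmodule m U)
  have htop := Submodule.finrank_le (C ⊔ colSubmodule m U)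
  rw [Module.finrank_matrix, Module.finrank_self, Fintype.card_fin, Fintype.card_fin,
    mul_one] at htop
  rw [finrank_colSubmodule, hU, hk, ← mul_add,
    show n - (e + 1) + 1 + (e + 1) = n + 1 by omega, Nat.mul_succ, mul_comm m n] at hlower
  omega

theorem stmt_12 {F : Type*} [Field F] [Fintype F] {n m d : ℕ}
    (hn : 2 ≤ n) (hnm : n ≤ m) (hd1 : 1 ≤ d) (hdn : d ≤ n)
    (C : Submodule F (Matrix (Fin n) (Fin m) F))
    (hk : Module.finrank F C = m * (n - d + 1))
    (hmin : ∀ X ∈ C, X ≠ 0 → d ≤ X.rank)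
    (hex : ∃ X ∈ C, X ≠ 0 ∧ X.rank = d)
    (U : Submodule F (Fin n → F)) (hU : Module.finrank F U = d) :
    {X | X ∈ C ∧ colSpan X ≤ U}.ncard = (Fintype.card F) ^ m := by
  have hset : {X | X ∈ C ∧ colSpan X ≤ U} =
      ((C ⊓ colSubmodule m U : Submodule F _) : Set (Matrix (Fin n) (Fin m) F)) := by
    ext X
    simp [mem_colSubmodule_iff_colSpan_le]
  rw [hset, ← Nat.card_coe_set_eq, ← Nat.card_eq_fintype_card]
  conv_rhs => rw [← finrank_inf_colSubmodule hd1 hdn C hk hmin U hU]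
  exact Module.natCard_eq_pow_finrank
end

section
/- There exists, for every m ≥ n+1 and every 1 ≤ d ≤ n−1, an F_q-linear code C ⊆ F_q^{n×m} of minimum rank distance d such that the rank-d codewords of C hold the trivial design (every d-dimensional subspace of F_q^n is the column space of some rank-d codeword), yet C is not MRD and d(C) + d(C*) ≤ n (so C is not dually QMRD). -/
open Matrix

/-- The dual code with respect to the trace bilinear form `⟨X, Y⟩ = Tr(X Yᵀ)`. -/
def dualCode {F : Type*} [Field F] {n m : ℕ} (C : Set (Matrix (Fin n) (Fin m) F)) :
    Set (Matrix (Fin n) (Fin m) F) :=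
  {Y | ∀ X ∈ C, Matrix.trace (X * Yᵀ) = 0}

open Polynomial in
/-- A nonzero linearized polynomial of `q`-degree less than `k` has a root space of dimension less
than `k`. -/
lemma finrank_lt_of_forall_sum_frobenius_eq_zero {F K : Type*} [Field F] [Fintype F] [Field K]
    [Algebra F K] [FiniteDimensional F K] {k : ℕ} {f : Fin k → K} (hf : f ≠ 0)
    (W : Submodule F K) (hW : ∀ x ∈ W, ∑ l, f l * x ^ (Fintype.card F ^ (l : ℕ)) = 0) :
    Module.finrank F W < k := by
  classical
  have : Finite K := Module.finite_of_finite F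
  have : Fintype K := Fintype.ofFinite K
  have hq : 1 < Fintype.card F := Fintype.one_lt_card
  obtain ⟨l₀, hl₀⟩ := Function.ne_iff.mp hf
  have hk : 0 < k := l₀.pos
  let P : K[X] := ∑ l, C (f l) * X ^ (Fintype.card F ^ (l : ℕ))
  have hP : P ≠ 0 := by
    intro h
    apply hl₀
    have h' : P.coeff (Fintype.card F ^ (l₀ : ℕ)) = 0 := by rw [h, coeff_zero]
    simp only [P, finsetSum_coeff, coeff_C_mul, coeff_X_pow] at h'
    rw [Finset.sum_eq_single l₀] at h'
    · simpa using h'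
    · intro l _ hl
      rw [if_neg, mul_zero]
      exact fun h => hl (Fin.ext (Nat.pow_right_injective hq h).symm)
    · simp
  have hdeg : P.natDegree ≤ Fintype.card F ^ (k - 1) := by
    refine natDegree_sum_le_of_forall_le _ _ fun l _ => (natDegree_C_mul_X_pow_le _ _).trans ?_
    exact Nat.pow_le_pow_right hq.le (by omega)
  have hsub : (W : Set K).toFinset ⊆ P.roots.toFinset := by
    intro x hx
    rw [Multiset.mem_toFinset, mem_roots hP, IsRoot.def]
    simpa [P, eval_finsetSum] using hW x (by simpa using hx)
  have hcard : Fintype.card F ^ Module.finrank F W ≤ Fintype.card F ^ (k - 1) :=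
    calc Fintype.card F ^ Module.finrank F W = Fintype.card W := Module.card_eq_pow_finrank.symm
      _ = (W : Set K).toFinset.card := (Set.toFinset_card _).symm
      _ ≤ P.roots.toFinset.card := Finset.card_le_card hsub
      _ ≤ P.roots.card := Multiset.toFinset_card_le _
      _ ≤ P.natDegree := card_roots' P
      _ ≤ _ := hdeg
  have := (Nat.pow_le_pow_iff_right hq).mp hcard
  omega

/-- Existence of Gabidulin codes: MRD codes of every admissible minimum distance. -/
lemma exists_mrd_code (F : Type*) [Field F] [Fintype F] {n m d : ℕ} (hnm : n ≤ m)
    (hd1 : 1 ≤ d) (hdn : d ≤ n) :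
    ∃ C : Submodule F (Matrix (Fin n) (Fin m) F),
      Module.finrank F C = m * (n - d + 1) ∧ ∀ X ∈ C, X ≠ 0 → d ≤ X.rank := by
  obtain ⟨p, _⟩ := CharP.exists F
  have : Fact p.Prime := ⟨CharP.char_is_prime F p⟩
  have : NeZero m := ⟨by omega⟩
  let K := FiniteField.Extension F p m
  have hK : Module.finrank F K = m := FiniteField.finrank_extension F p m
  let b : Module.Basis (Fin m) F K := Module.finBasisOfFinrankEq F K hK
  let α : (Fin n → F) →ₗ[F] K := Fintype.linearCombination F (b ∘ Fin.castLE hnm)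
  have hα : Function.Injective α :=
    linearIndependent_iff_injective_fintypeLinearCombination.mp
      (b.linearIndependent.comp _ (Fin.castLE_injective hnm))
  let ev : (Fin (n - d + 1) → K) →ₗ[F] K →ₗ[F] K :=
    ∑ l : Fin (n - d + 1), (LinearMap.mul F K ∘ₗ LinearMap.proj l).compl₂
      (FiniteField.frobeniusAlgHom F K ^ (l : ℕ)).toLinearMap
  have hev (f x) : ev f x = ∑ l, f l * x ^ (Fintype.card F ^ (l : ℕ)) := by
    simp [ev, AlgHom.coe_pow, FiniteField.coe_frobeniusAlgHom, pow_iterate]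
  let Φ : (Fin (n - d + 1) → K) →ₗ[F] Matrix (Fin n) (Fin m) F :=
    { toFun f := .of fun i j => b.repr (ev f (b (Fin.castLE hnm i))) j
      map_add' f g := by ext; simp
      map_smul' c f := by ext; simp }
  have hΦ (f) (v : Fin n → F) (j) : ((Φ f)ᵀ *ᵥ v) j = b.repr (ev f (α v)) j := by
    simp [Φ, α, mulVec, dotProduct, Fintype.linearCombination_apply, mul_comm]
  have hrank {f} (hf : f ≠ 0) : d ≤ (Φ f).rank := by
    let N := LinearMap.ker (Φ f)ᵀ.mulVecLin
    have hN : Module.finrank F N < n - d + 1 := by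
      rw [(Submodule.equivMapOfInjective α hα N).finrank_eq]
      refine finrank_lt_of_forall_sum_frobenius_eq_zero hf _ ?_
      rintro _ ⟨v, hv, rfl⟩
      rw [← hev]
      apply b.repr.injective
      ext j
      rw [← hΦ, ← mulVecLin_apply, LinearMap.mem_ker.mp hv]
      simp
    have hsum := LinearMap.finrank_range_add_finrank_ker (Φ f)ᵀ.mulVecLin
    rw [Module.finrank_fin_fun] at hsum
    rw [← rank_transpose, rank]
    change Module.finrank F (LinearMap.ker _) < _ at hN
    omega
  have hinj : Function.Injective Φ := by
    rw [injective_iff_map_eq_zero]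
    intro f hf
    by_contra hne
    have := hrank hne
    rw [hf, rank_zero] at this
    omega
  refine ⟨LinearMap.range Φ, ?_, ?_⟩
  · rw [LinearMap.finrank_range_of_inj hinj, Module.finrank_pi_fintype]
    simp [hK, mul_comm]
  · rintro _ ⟨f, rfl⟩ hX
    exact hrank (by rintro rfl; simp at hX)

/-- A code of large dimension contains a nonzero codeword supported on any given subspace. -/
lemma exists_colSpan_le {F : Type*} [Field F] {n m d : ℕ}
    (C : Submodule F (Matrix (Fin n) (Fin m) F)) (hC : m * (n - d) < Module.finrank F C)
    (U : Submodule F (Fin n → F)) (hU : Module.finrank F U = d) :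
    ∃ X ∈ C, X ≠ 0 ∧ colSpan X ≤ U := by
  let g : Matrix (Fin n) (Fin m) F →ₗ[F] Fin m → (Fin n → F) ⧸ U :=
    LinearMap.pi fun j => U.mkQ ∘ₗ LinearMap.pi fun i => entryLinearMap F F i j
  have hfin : Module.finrank F ((Fin n → F) ⧸ U) = n - d := by
    have := U.finrank_quotient_add_finrank
    rw [Module.finrank_fin_fun] at this
    omega
  have hker : LinearMap.ker (g ∘ₗ C.subtype) ≠ ⊥ := by
    apply LinearMap.ker_ne_bot_of_finrank_lt
    rw [Module.finrank_pi_fintype]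
    simpa [hfin] using hC
  obtain ⟨X, hX, hX0⟩ := Submodule.exists_mem_ne_zero_of_ne_bot hker
  refine ⟨X, X.2, by simpa using hX0, ?_⟩
  rw [colSpan, range_mulVecLin, Submodule.span_le]
  rintro _ ⟨j, rfl⟩
  have := congrFun (LinearMap.mem_ker.mp hX) j
  exact (Submodule.Quotient.mk_eq_zero U).mp this

/-- Appending a zero column to a matrix. -/
def appendZeroCol (F : Type*) [Field F] (n m : ℕ) :
    Matrix (Fin n) (Fin m) F →ₗ[F] Matrix (Fin n) (Fin (m + 1)) F where
  toFun X := .of fun i => Fin.snoc (α := fun _ => F) (X i) 0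
  map_add' X Y := by ext i j; cases j using Fin.lastCases <;> simp
  map_smul' c X := by ext i j; cases j using Fin.lastCases <;> simp

section appendZeroCol

variable {F : Type*} [Field F] {n m : ℕ}

@[simp]
lemma appendZeroCol_castSucc (X : Matrix (Fin n) (Fin m) F) (i : Fin n) (j : Fin m) :
    appendZeroCol F n m X i j.castSucc = X i j := by
  simp [appendZeroCol]

@[simp]
lemma appendZeroCol_last (X : Matrix (Fin n) (Fin m) F) (i : Fin n) :
    appendZeroCol F n m X i (Fin.last m) = 0 := by
  simp [appendZeroCol]

lemma appendZeroCol_injective : Function.Injective (appendZeroCol F n m) := by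
  intro X Y h
  ext i j
  rw [← appendZeroCol_castSucc X, h, appendZeroCol_castSucc]

lemma colSpan_appendZeroCol (X : Matrix (Fin n) (Fin m) F) :
    colSpan (appendZeroCol F n m X) = colSpan X := by
  ext u
  simp only [colSpan, LinearMap.mem_range, mulVecLin_apply]
  constructor
  · rintro ⟨v, rfl⟩
    exact ⟨fun j => v j.castSucc, by ext i; simp [mulVec, dotProduct, Fin.sum_univ_castSucc]⟩
  · rintro ⟨v, rfl⟩
    exact ⟨Fin.snoc (α := fun _ => F) v 0, by
      ext i; simp [mulVec, dotProduct, Fin.sum_univ_castSucc]⟩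

lemma rank_eq_finrank_colSpan (X : Matrix (Fin n) (Fin m) F) :
    X.rank = Module.finrank F (colSpan X) := rfl

lemma rank_appendZeroCol (X : Matrix (Fin n) (Fin m) F) :
    (appendZeroCol F n m X).rank = X.rank := by
  rw [rank_eq_finrank_colSpan, colSpan_appendZeroCol, rank_eq_finrank_colSpan]

lemma single_last_mem_dualCode (C : Submodule F (Matrix (Fin n) (Fin m) F)) (i : Fin n) :
    single i (Fin.last m) (1 : F) ∈
      dualCode (C.map (appendZeroCol F n m) : Set (Matrix (Fin n) (Fin (m + 1)) F)) := by
  rintro _ ⟨X, -, rfl⟩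
  rw [transpose_single, trace_mul_single]
  simp

end appendZeroCol

theorem stmt_17 {F : Type*} [Field F] [Fintype F] {n m d : ℕ}
    (hn : 2 ≤ n) (hm : n + 1 ≤ m) (hd1 : 1 ≤ d) (hdn : d ≤ n - 1) :
    ∃ C : Submodule F (Matrix (Fin n) (Fin m) F),
      -- C has minimum rank distance d
      (∀ X ∈ C, X ≠ 0 → d ≤ X.rank) ∧ (∃ X ∈ C, X ≠ 0 ∧ X.rank = d) ∧
      -- the rank-d codewords of C hold the trivial design
      (∀ U : Submodule F (Fin n → F), Module.finrank F U = d →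
        ∃ X ∈ C, X.rank = d ∧ colSpan X = U) ∧
      -- C is not MRD
      Module.finrank F C ≠ max n m * (min n m - d + 1) ∧
      -- d(C) + d(C*) ≤ n, so C is not dually QMRD
      (∃ Y ∈ dualCode (C : Set (Matrix (Fin n) (Fin m) F)), Y ≠ 0 ∧ d + Y.rank ≤ n) := by
  obtain ⟨m, rfl⟩ : ∃ k, m = k + 1 := ⟨m - 1, by omega⟩
  obtain ⟨C, hdim, hdist⟩ := exists_mrd_code F (n := n) (m := m) (d := d) (by omega) hd1 (by omega)
  have hdesign (U : Submodule F (Fin n → F)) (hU : Module.finrank F U = d) :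
      ∃ X ∈ C.map (appendZeroCol F n m), X.rank = d ∧ colSpan X = U := by
    obtain ⟨X, hXC, hX0, hXU⟩ := exists_colSpan_le C (by rw [hdim]; gcongr <;> omega) U hU
    have hspan : colSpan X = U :=
      Submodule.eq_of_le_of_finrank_le hXU (hU.trans_le (hdist X hXC hX0))
    refine ⟨_, ⟨X, hXC, rfl⟩, ?_, by rw [colSpan_appendZeroCol, hspan]⟩
    rw [rank_appendZeroCol, rank_eq_finrank_colSpan, hspan, hU]
  refine ⟨C.map (appendZeroCol F n m), ?_, ?_, hdesign, ?_, ?_⟩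
  · rintro _ ⟨X, hX, rfl⟩ h0
    rw [rank_appendZeroCol]
    exact hdist X hX (by rintro rfl; simp at h0)
  · have hli := (Pi.basisFun F (Fin n)).linearIndependent.comp _
      (Fin.castLE_injective (show d ≤ n by omega))
    obtain ⟨X, hX, hXd, -⟩ := hdesign _ ((finrank_span_eq_card hli).trans (Fintype.card_fin d))
    refine ⟨X, hX, ?_, hXd⟩
    rintro rfl
    rw [rank_zero] at hXd
    omega
  · rw [← (Submodule.equivMapOfInjective _ appendZeroCol_injective C).finrank_eq, hdim,
      max_eq_right (by omega), min_eq_left (by omega)]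
    intro h
    have := Nat.eq_of_mul_eq_mul_right (by omega) h
    omega
  · refine ⟨_, single_last_mem_dualCode C ⟨0, by omega⟩, ?_, ?_⟩
    · exact fun h => one_ne_zero ((single_apply_same _ _ _).symm.trans (congr_fun₂ h _ _))
    · have : (single (⟨0, by omega⟩ : Fin n) (Fin.last m) (1 : F)).rank ≤ 1 := by
        rw [single_eq_single_vecMulVec_single]
        exact rank_vecMulVec_le _ _
      omega
end
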